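/- Let Ψ(z) = 1 + sin z, which is analytic and injective on 𝔻 with Ψ(0) = 1, and let c ≥ 0 be an integer. If f is a normalized analytic function on 𝔻 in the class S*_s, i.e., f(z) ≠ 0 and z·f'(z)/f(z) ∈ Ψ(𝔻) = {1 + sin w : w ∈ 𝔻} for all z ∈ 𝔻 \ {0} (z f'/f ≺ 1 + sin z), then its Bernardi transform F = B_c(f) satisfies F(z) ≠ 0 and z·F'(z)/F(z) ∈ Ψ(𝔻) for all z ∈ 𝔻 \ {0}. Hence B_c(S*_s) ⊆ S*_s. -/

import Mathlib

open Complex Metric Set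

/-- Integral along the segment from `0` to `z`: `∫₀ᶻ g(ζ) dζ = z • ∫₀¹ g(tz) dt`. -/
noncomputable def segIntegral (g : ℂ → ℂ) (z : ℂ) : ℂ :=
  z * ∫ t in (0:ℝ)..1, g ((t : ℂ) * z)

/-- The integrand `ζ^(c-1) f(ζ) = ζ^c · (f(ζ)/ζ)`, with `f(ζ)/ζ` extended by `f'(0)` at `ζ = 0`. -/
noncomputable def bernardiIntegrand (c : ℕ) (f : ℂ → ℂ) (ζ : ℂ) : ℂ :=
  (if ζ = 0 then deriv f 0 else f ζ / ζ) * ζ ^ c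

/-- The Bernardi transform `B_c(f)(z) = ((1+c)/z^c) ∫₀ᶻ ζ^(c-1) f(ζ) dζ`, with value `0` at `0`. -/
noncomputable def bernardi (c : ℕ) (f : ℂ → ℂ) (z : ℂ) : ℂ :=
  if z = 0 then 0 else ((1 + c : ℂ) / z ^ c) * segIntegral (bernardiIntegrand c f) z

theorem cubic_sine_approx_le {x y : ℝ} (h : x ^ 2 + y ^ 2 = 1) :
    3 / 2 * x - 2 / 3 * x ^ 3 + (y / 2 + 2 / 3 * y ^ 3) / 4 ≤ 49 / 50 := by
  have hx1 : x ≤ 1 := by nlinarith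
  have hx2 : -1 ≤ x := by nlinarith
  have hy : y ≤ (149 / 100 - x ^ 2) / (7 / 5) := by nlinarith [sq_nonneg (y - 7 / 10)]
  have e : y / 2 + 2 / 3 * y ^ 3 = y * (7 / 6 - 2 / 3 * x ^ 2) := by
    have : y ^ 3 = y * (1 - x ^ 2) := by rw [← h]; ring
    rw [this]; ring
  have h2 : y * (7 / 6 - 2 / 3 * x ^ 2) ≤ (149 / 100 - x ^ 2) / (7 / 5) * (7 / 6 - 2 / 3 * x ^ 2) :=
    mul_le_mul_of_nonneg_right hy (by nlinarith)
  rw [e]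
  rcases le_total x 0 with h0 | h0
  · nlinarith [mul_nonneg (neg_nonneg.2 h0) (sq_nonneg x),
    mul_nonneg (neg_nonneg.2 h0) (by nlinarith : 0 ≤ 1 - x^2), sq_nonneg (x^2),
    mul_nonneg (sq_nonneg x) (by nlinarith : 0 ≤ 1 - x^2)]
  · have h1 : 0 ≤ x * (1 - x) * (x - 7 / 10) ^ 2 := by have := sub_nonneg.2 hx1; positivity
    have h3 : 0 ≤ x * (x - 7 / 10) ^ 2 := by positivity
    have k : 3 / 2 * x - 2 / 3 * x ^ 3 + (149 / 100 - x ^ 2) / (7 / 5) * (7 / 6 -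
      2 / 3 * x ^ 2) / 4 ≤ 49 / 50 := by
      nlinarith [sq_nonneg (x - 7 / 10), sq_nonneg (x - 71 / 100)]
    linarith

theorem mul_sq_lt_sq_of_le_seven_tenths {S : ℝ} (h1 : 3 / 20 ≤ S) (h2 : S ≤ 7 / 10) :
    (1 - S ^ 2) * (2577 / 625 * S - (6419 / 10000 + 179 / 500 * S ^ 2)) ^ 2 <
      (S * (49 / 20 - S / 5)) ^ 2 := by
  obtain ⟨a, rfl⟩ : ∃ a, S = a + 3/20 := ⟨S - 3/20, by ring⟩
  rcases le_total (a+3/20) (1/2) with h3 | h3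
  · have ha : 0 ≤ a := by linarith
    have hb : 0 ≤ 7/20 - a := by linarith
    nlinarith [pow_nonneg ha 2, pow_nonneg ha 3, pow_nonneg ha 4, pow_nonneg ha 5,
      pow_nonneg ha 6, mul_nonneg (pow_nonneg ha 2) hb, mul_nonneg (pow_nonneg ha 3) hb,
      mul_nonneg (pow_nonneg ha 4) hb, mul_nonneg (pow_nonneg ha 5) hb, sq_nonneg (a - 1/4)]
  · have ha : 0 ≤ a - 7 / 20 := by linarith
    have hb : 0 ≤ 11/20 - a := by linarith
    nlinarith [mul_nonneg (pow_nonneg ha 0) (pow_nonneg hb 6),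
      mul_nonneg (pow_nonneg ha 1) (pow_nonneg hb 5),
      mul_nonneg (pow_nonneg ha 2) (pow_nonneg hb 4),
      mul_nonneg (pow_nonneg ha 3) (pow_nonneg hb 3),
      mul_nonneg (pow_nonneg ha 4) (pow_nonneg hb 2),
      mul_nonneg (pow_nonneg ha 5) (pow_nonneg hb 1),
      mul_nonneg (pow_nonneg ha 6) (pow_nonneg hb 0)]

theorem mul_sq_lt_sq_of_seven_tenths_le {S : ℝ} (h1 : 7 / 10 ≤ S) (h2 : S ≤ 1) :
    (1 - S ^ 2) * (2577 / 625 * S - (6419 / 10000 + 179 / 500 * S ^ 2)) ^ 2 <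
      (S * (59 / 20 - 19/20 * S)) ^ 2 := by
  have ha : 0 ≤ S - 7 / 10 := by linarith
  have hb : 0 ≤ 1 - S := by linarith
  nlinarith [mul_nonneg (pow_nonneg ha 0) (pow_nonneg hb 6),
    mul_nonneg (pow_nonneg ha 1) (pow_nonneg hb 5),
    mul_nonneg (pow_nonneg ha 2) (pow_nonneg hb 4),
    mul_nonneg (pow_nonneg ha 3) (pow_nonneg hb 3),
    mul_nonneg (pow_nonneg ha 4) (pow_nonneg hb 2),
    mul_nonneg (pow_nonneg ha 5) (pow_nonneg hb 1), mul_nonneg (pow_nonneg ha 6) (pow_nonneg hb 0)]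

/-- A polynomial `D` for which `x / D x` dominates `tan x` on `[0, 1]`. -/
noncomputable def tanDenom (x : ℝ) : ℝ := 1 - x ^ 2 / 3 - x ^ 4 / 45 - x ^ 6 / 400

theorem tan_cot_bound_lt {S C : ℝ} (hS : 0 < S) (hC : 0 ≤ C) (h : S ^ 2 + C ^ 2 = 1) :
    2577 / 2500 * ((C / tanDenom C + S * (1 / 3 + 59 / 400 * S ^ 2)) / 2) < 1 / 2 +
      C / (8 * S) := by
  have hS1 : S ≤ 1 := by nlinarith
  set E := 6419 / 10000 + 179 / 500 * S ^ 2 with hE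
  set m := 4 - 2577 / 625 * (S * (1 / 3 + 59 / 400 * S ^ 2)) with hm
  have hE0 : 0 < E := by positivity
  have hED : E ≤ tanDenom C := by
    have e : C ^ 2 = 1 - S ^ 2 := by linarith
    have : tanDenom C = 1 - (1 - S ^ 2) / 3 - (1 - S ^ 2) ^ 2 / 45 - (1 - S ^ 2) ^ 3 / 400 := by
      rw [← e, tanDenom]; ring
    rw [this, hE]
    have h2 : 0 ≤ S ^ 2 := by positivity
    have h3 : 0 ≤ 1 - S ^ 2 := by nlinarith
    generalize S ^ 2 = s at *
    nlinarith [mul_nonneg h2 h3, mul_nonneg (mul_nonneg h2 h2) h3, mul_nonneg h2 (sq_nonneg s)]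
  have hm0 : 0 < m := by
    rw [hm]
    nlinarith [mul_nonneg hS.le (sub_nonneg.2 hS1), pow_pos hS 3, pow_le_one₀ hS.le hS1 (n := 3)]
  have key : C * (2577 / 625 * S - E) < S * (E * m) := by
    rcases le_or_gt (2577 / 625 * S) E with h5 | h5
    · have : C * (2577 / 625 * S - E) ≤ 0 := mul_nonpos_of_nonneg_of_nonpos hC (by linarith)
      have : 0 < S * (E * m) := by positivity
      linarith
    have h15 : 3 / 20 ≤ S := by
      by_contra! hc
      nlinarith
    have e : C ^ 2 = 1 - S ^ 2 := by linarith
    rcases le_total S (7 / 10) with h7 | h7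
    · have hM : 49 / 20 - S / 5 ≤ E * m := by
        rw [hE, hm]
        nlinarith [mul_nonneg (sub_nonneg.2 h15) (sub_nonneg.2 h7),
          mul_nonneg (mul_nonneg (sub_nonneg.2 h15) (sub_nonneg.2 h7)) hS.le,
          mul_nonneg (mul_nonneg (sub_nonneg.2 h15) (sub_nonneg.2 h7)) (sq_nonneg S),
          mul_nonneg (mul_nonneg (sub_nonneg.2 h15) (sub_nonneg.2 h7)) (pow_nonneg hS.le 3),
          sq_nonneg (S - 4/10), mul_nonneg hS.le (sq_nonneg (S - 4/10))]
      have h8 : C * (2577 / 625 * S - E) < S * (49 / 20 - S / 5) := by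
        refine lt_of_pow_lt_pow_left₀ 2 (by nlinarith) ?_
        rw [mul_pow, e]
        exact mul_sq_lt_sq_of_le_seven_tenths h15 h7
      nlinarith
    · have hM : 59 / 20 - 19 / 20 * S ≤ E * m := by
        rw [hE, hm]
        nlinarith [mul_nonneg (sub_nonneg.2 h7) (sub_nonneg.2 hS1),
          mul_nonneg (mul_nonneg (sub_nonneg.2 h7) (sub_nonneg.2 hS1)) hS.le,
          mul_nonneg (mul_nonneg (sub_nonneg.2 h7) (sub_nonneg.2 hS1)) (sq_nonneg S),
          mul_nonneg (mul_nonneg (sub_nonneg.2 h7) (sub_nonneg.2 hS1)) (pow_nonneg hS.le 3)]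
      have h8 : C * (2577 / 625 * S - E) < S * (59 / 20 - 19 / 20 * S) := by
        refine lt_of_pow_lt_pow_left₀ 2 (by nlinarith) ?_
        rw [mul_pow, e]
        exact mul_sq_lt_sq_of_seven_tenths_le h7 hS1
      nlinarith
  have h9 : C / tanDenom C ≤ C / E := div_le_div_of_nonneg_left hC hE0 hED
  have h10 : 2577 / 2500 * ((C / E + S * (1 / 3 + 59 / 400 * S ^ 2)) / 2) < 1 / 2 +
    C / (8 * S) := by
    have e1 : 1 / 2 + C / (8 * S) - 2577 / 2500 * ((C / E + S * (1 / 3 + 59 / 400 * S ^ 2)) / 2) =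
      (S * (E * m) - C * (2577 / 625 * S - E)) / (8 * S * E) := by
      rw [hm]; field_simp; ring
    have : 0 < (S * (E * m) - C * (2577 / 625 * S - E)) / (8 * S * E) := by
      apply div_pos (by linarith) (by positivity)
    linarith
  linarith

theorem tanDenom_pos {x : ℝ} (h0 : 0 ≤ x) (h1 : x ≤ 1) : 0 < tanDenom x := by
  have := pow_le_one₀ h0 h1 (n := 2)
  have := pow_le_one₀ h0 h1 (n := 4)
  have := pow_le_one₀ h0 h1 (n := 6)
  unfold tanDenom; linarith

theorem hasDerivAt_tanDenom (x : ℝ) :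
    HasDerivAt tanDenom (-(2 * x / 3) - 4 * x ^ 3 / 45 - 6 * x ^ 5 / 400) x := by
  have h := (((hasDerivAt_const x (1:ℝ)).sub ((hasDerivAt_pow 2 x).div_const 3)).sub
    ((hasDerivAt_pow 4 x).div_const 45)).sub ((hasDerivAt_pow 6 x).div_const 400)
  refine h.congr_deriv ?_
  norm_num

theorem tanDenom_ineq {x : ℝ} (h0 : 0 ≤ x) (h1 : x ≤ 1) :
    tanDenom x ^ 2 + x ^ 2 ≤
      tanDenom x - x * (-(2 * x / 3) - 4 * x ^ 3 / 45 - 6 * x ^ 5 / 400) := by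
  have h2 := pow_le_one₀ h0 h1 (n := 2)
  have h4 := pow_le_one₀ h0 h1 (n := 4)
  have h6 := pow_le_one₀ h0 h1 (n := 6)
  have : 0 ≤ x ^ 6 * (7 / 400 - 2 / 135 - (1 / 2025 + 2 / 1200) * x ^ 2 - 2 / 18000 * x ^ 4
    - x ^ 6 / 160000) := mul_nonneg (by positivity) (by linarith)
  unfold tanDenom
  linarith

theorem cos_ne_zero_of_norm_lt {z : ℂ} (h : ‖z‖ < 3 / 2) : Complex.cos z ≠ 0 := by
  rw [Complex.cos_ne_zero_iff]
  rintro k rfl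
  have e : ((2 * k + 1) * Real.pi / 2 : ℂ) = (((2 * k + 1 : ℤ) * (Real.pi / 2) : ℝ) : ℂ) := by
    push_cast; ring
  have hk : (1 : ℝ) ≤ |((2 * k + 1 : ℤ) : ℝ)| := by
    rw [← Int.cast_abs]
    exact_mod_cast Int.one_le_abs (by lia)
  rw [e, Complex.norm_real, Real.norm_eq_abs, abs_mul, abs_of_pos Real.pi_div_two_pos] at h
  nlinarith [Real.pi_gt_three]

theorem sin_ne_zero_of_norm_lt {z : ℂ} (h : ‖z‖ < 3) (hz : z ≠ 0) : Complex.sin z ≠ 0 := by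
  rw [Complex.sin_ne_zero_iff]
  rintro k rfl
  have e : (k * Real.pi : ℂ) = ((k * Real.pi : ℝ) : ℂ) := by push_cast; ring
  have hk : (1 : ℝ) ≤ |(k : ℝ)| := by
    rw [← Int.cast_abs]
    refine mod_cast Int.one_le_abs ?_
    rintro rfl
    simp at hz
  rw [e, Complex.norm_real, Real.norm_eq_abs, abs_mul, abs_of_pos Real.pi_pos] at h
  nlinarith [Real.pi_gt_three]

theorem injOn_sin_ball : InjOn Complex.sin (ball 0 (3 / 2)) := by
  intro a ha b hb hab
  rw [mem_ball_zero_iff] at ha hb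
  by_contra hne
  have h := Complex.sin_sub_sin a b
  rw [hab, sub_self, eq_comm] at h
  have h1 : ‖(a - b) / 2‖ < 3 := by
    have := norm_sub_le a b
    simp only [norm_div, Complex.norm_ofNat]; linarith
  have h2 : ‖(a + b) / 2‖ < 3 / 2 := by
    have := norm_add_le a b
    simp only [norm_div, Complex.norm_ofNat]; linarith
  have h3 := sin_ne_zero_of_norm_lt h1 (div_ne_zero (sub_ne_zero.2 hne) two_ne_zero)
  have h4 := cos_ne_zero_of_norm_lt h2
  simp [h3, h4] at h

theorem norm_tan_le {z : ℂ} (hz : ‖z‖ < 1) : ‖Complex.tan z‖ ≤ ‖z‖ / tanDenom ‖z‖ := by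
  have main : ∀ ρ ∈ Ioc ‖z‖ 1, ‖Complex.tan z‖ ≤ ρ / tanDenom ρ := by
    intro ρ ⟨hρ, hρ1⟩
    have hρ0 : 0 < ρ := (norm_nonneg z).trans_lt hρ
    have hB : ∀ t ∈ Icc (0:ℝ) 1, HasDerivAt (fun t : ℝ => (t * ρ) / tanDenom (t * ρ))
        ((tanDenom (t * ρ) - (t * ρ) * (-(2 * (t * ρ) / 3) - 4 * (t * ρ) ^ 3 / 45
          - 6 * (t * ρ) ^ 5 / 400)) / tanDenom (t * ρ) ^ 2 * ρ) t := by
      intro t ht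
      have hx : 0 < tanDenom (t * ρ) :=
        tanDenom_pos (mul_nonneg ht.1 hρ0.le) (mul_le_one₀ ht.2 hρ0.le hρ1)
      have h1 := ((hasDerivAt_id (t * ρ)).div (hasDerivAt_tanDenom (t * ρ)) hx.ne').comp t
        ((hasDerivAt_id t).mul_const ρ)
      refine h1.congr_deriv ?_
      simp
    have hf : ∀ t ∈ Icc (0:ℝ) 1, HasDerivAt (fun t : ℝ => Complex.tan (t * z))
        (z * (1 + Complex.tan (t * z) ^ 2)) t := by
      intro t ht
      have hc : Complex.cos (t * z) ≠ 0 := by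
        apply cos_ne_zero_of_norm_lt
        rw [norm_mul, Complex.norm_real, Real.norm_of_nonneg ht.1]
        linarith [mul_le_one₀ ht.2 (norm_nonneg z) hz.le]
      have h1 : HasDerivAt (fun x : ℂ => Complex.tan (x * z))
          (1 / Complex.cos (t * z) ^ 2 * (1 * z)) (t : ℂ) :=
        HasDerivAt.comp (h₂ := Complex.tan) (h := fun x : ℂ => x * z) (t : ℂ)
          (Complex.hasDerivAt_tan hc) ((hasDerivAt_id (t : ℂ)).mul_const z)
      refine h1.comp_ofReal.congr_deriv ?_
      have h2 := Complex.sin_sq_add_cos_sq (t * z)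
      rw [Complex.tan_eq_sin_div_cos]
      field_simp
      linear_combination -z * h2
    have := image_norm_le_of_norm_deriv_right_lt_deriv_boundary' (a := 0) (b := 1)
      (f := fun t : ℝ => Complex.tan (t * z))
      (fun t ht => (hf t ht).continuousAt.continuousWithinAt)
      (fun t ht => (hf t ⟨ht.1, ht.2.le⟩).hasDerivWithinAt)
      (B := fun t : ℝ => (t * ρ) / tanDenom (t * ρ)) (by simp)
      (fun t ht => (hB t ht).continuousAt.continuousWithinAt)
      (fun t ht => (hB t ⟨ht.1, ht.2.le⟩).hasDerivWithinAt)
      (fun t ht hn => ?_) (right_mem_Icc.2 zero_le_one)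
    · simpa using this
    · have hx0 : 0 ≤ t * ρ := mul_nonneg ht.1 hρ0.le
      have hx1 : t * ρ ≤ 1 := mul_le_one₀ ht.2.le hρ0.le hρ1
      have hx : 0 < tanDenom (t * ρ) := tanDenom_pos hx0 hx1
      have hi := tanDenom_ineq hx0 hx1
      have h2 : 1 + ((t * ρ) / tanDenom (t * ρ)) ^ 2 ≤ (tanDenom (t * ρ) -
        (t * ρ) * (-(2 * (t * ρ) / 3)
          - 4 * (t * ρ) ^ 3 / 45 - 6 * (t * ρ) ^ 5 / 400)) / tanDenom (t * ρ) ^ 2 := by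
        rw [le_div_iff₀ (by positivity)]
        refine le_trans (le_of_eq ?_) hi
        field_simp
      have h3 : ‖1 + Complex.tan (t * z) ^ 2‖ ≤ 1 + ((t * ρ) / tanDenom (t * ρ)) ^ 2 := by
        refine (norm_add_le _ _).trans ?_
        rw [norm_pow, norm_one, hn]
      have h4 : 0 < 1 + ((t * ρ) / tanDenom (t * ρ)) ^ 2 := by positivity
      rw [norm_mul]
      nlinarith [norm_nonneg z, norm_nonneg (1 + Complex.tan (t * z) ^ 2)]
  have hD := tanDenom_pos (norm_nonneg z) hz.le
  have hcont : ContinuousAt (fun ρ : ℝ => ρ / tanDenom ρ) ‖z‖ :=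
    continuousAt_id.div (hasDerivAt_tanDenom _).continuousAt hD.ne'
  refine ge_of_tendsto (hcont.tendsto.mono_left (nhdsWithin_le_nhds (s := Ioi ‖z‖))) ?_
  filter_upwards [Ioc_mem_nhdsGT hz] with ρ hρ using main ρ hρ

theorem norm_inv_sub_cot_le {z : ℂ} (h : ‖z‖ ≤ 1) (hz : z ≠ 0) :
    ‖1 / z - Complex.cos z / Complex.sin z‖ ≤ ‖z‖ * (1 / 3 + 59 / 400 * ‖z‖ ^ 2) := by
  have hs := sin_ne_zero_of_norm_lt (by linarith) hz
  have h1 := Complex.sin_bound h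
  have h2 := Complex.cos_bound h
  set r := ‖z‖ with hr
  have hp : 0 < r := norm_pos_iff.2 hz
  have e : 1 / z - Complex.cos z / Complex.sin z =
      (Complex.sin z - z * Complex.cos z) / (z * Complex.sin z) := by
    field_simp
  have h3 : ‖Complex.sin z - z * Complex.cos z‖ ≤ r ^ 3 / 3 + r ^ 5 / 100 + r ^ 5 * (5 / 96) := by
    have e2 : Complex.sin z - z * Complex.cos z = z ^ 3 / 3 + (Complex.sin z - (z - z ^ 3 / 6))
      - z * (Complex.cos z - (1 - z ^ 2 / 2)) := by ring
    rw [e2]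
    refine (norm_sub_le _ _).trans (add_le_add ((norm_add_le _ _).trans (add_le_add ?_ h1)) ?_)
    · simp [hr]
    · rw [norm_mul, ← hr]
      calc r * _ ≤ r * (r ^ 4 * (5 / 96)) := by gcongr
        _ = _ := by ring
  have h4 : r - r ^ 3 / 6 - r ^ 5 / 100 ≤ ‖Complex.sin z‖ := by
    have h5 := norm_sub_norm_le (z - z ^ 3 / 6) (z - z ^ 3 / 6 - Complex.sin z)
    rw [norm_sub_rev (z - z ^ 3 / 6)] at h5
    have h6 : r - r ^ 3 / 6 ≤ ‖z - z ^ 3 / 6‖ := by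
      have := norm_sub_norm_le z (z ^ 3 / 6)
      simpa using this
    simp only [sub_sub_cancel] at h5
    linarith
  rw [e, norm_div, norm_mul, ← hr, div_le_iff₀ (by positivity)]
  refine h3.trans ?_
  have h7 : r * (1 / 3 + 59 / 400 * r ^ 2) * (r * (r - r ^ 3 / 6 - r ^ 5 / 100)) ≤
     r * (1 / 3 + 59 / 400 * r ^ 2) * (r * ‖Complex.sin z‖) := by gcongr
  refine le_trans ?_ h7
  have ha := pow_le_one₀ hp.le h (n := 2)
  have : 0 ≤ r ^ 5 * ((1 / 3 * (-1/6 - r ^ 2 / 100) + 59 / 400 * (1 - r ^ 2 / 6 -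
    r ^ 4 / 100)) - 1 / 100 - 5 / 96) := by
    apply mul_nonneg (by positivity)
    have hb := pow_le_one₀ hp.le h (n := 4)
    nlinarith
  nlinarith

theorem abs_im_sin_lt {w : ℂ} (hw : ‖w‖ = 1) :
    |(Complex.sin w).im| < 4 * (1 + (Complex.sin w).re) := by
  have hxy : w.re ^ 2 + w.im ^ 2 = 1 := by
    have := Complex.sq_norm w
    rw [hw, Complex.normSq_apply] at this
    linarith
  have h := Complex.sin_bound hw.le
  rw [hw] at h
  have hre := (Complex.abs_re_le_norm _).trans h
  have him := (Complex.abs_im_le_norm _).trans h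
  have e1 : (Complex.sin w - (w - w ^ 3 / 6)).re =
      (Complex.sin w).re - (3 / 2 * w.re - 2 / 3 * w.re ^ 3) := by
    have : (w ^ 3 / 6).re = (w.re ^ 3 - 3 * w.re * w.im ^ 2) / 6 := by
      rw [show (6 : ℂ) = ((6 : ℝ) : ℂ) by norm_num, Complex.div_ofReal_re]
      simp [pow_succ, Complex.mul_re, Complex.mul_im]; ring
    rw [Complex.sub_re, Complex.sub_re, this]
    linear_combination (-(w.re / 2)) * hxy
  have e2 : (Complex.sin w - (w - w ^ 3 / 6)).im =
      (Complex.sin w).im - (w.im / 2 + 2 / 3 * w.im ^ 3) := by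
    have : (w ^ 3 / 6).im = (3 * w.re ^ 2 * w.im - w.im ^ 3) / 6 := by
      rw [show (6 : ℂ) = ((6 : ℝ) : ℂ) by norm_num, Complex.div_ofReal_im]
      simp [pow_succ, Complex.mul_re, Complex.mul_im]; ring
    rw [Complex.sub_im, Complex.sub_im, this]
    linear_combination (w.im / 2) * hxy
  rw [e1, abs_le] at hre
  rw [e2, abs_le] at him
  have f1 := cubic_sine_approx_le (x := -w.re) (y := w.im) (by linarith)
  have f2 := cubic_sine_approx_le (x := -w.re) (y := -w.im) (by linarith)
  rw [abs_lt]
  constructor <;> linarith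

theorem sin_ne_add_ray_of_norm_eq {w ζ : ℂ} (hw : ‖w‖ = 1) (hζ : ‖ζ‖ = 1) (hne : ζ ≠ w)
    {r c : ℝ} (hr : 0 < r) (hc : 0 ≤ c) :
    Complex.sin ζ ≠ Complex.sin w + r * (w * Complex.cos w / (1 + c + Complex.sin w)) := by
  intro heq
  have hA := abs_im_sin_lt hw
  set q := 1 + c + Complex.sin w with hq
  have hqre : q.re = 1 + c + (Complex.sin w).re := by simp [hq]
  have hqim : q.im = (Complex.sin w).im := by simp [hq]
  have hq4 : |q.im| ≤ 4 * q.re := by rw [hqre, hqim]; linarith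
  have hq0 : q ≠ 0 := by
    intro h0
    have := abs_nonneg (Complex.sin w).im
    have : q.re = 0 := by rw [h0]; simp
    linarith
  set α := (w - ζ) / 2 with hα
  set β := (w + ζ) / 2 with hβ
  have hα0 : α ≠ 0 := div_ne_zero (sub_ne_zero.2 hne.symm) two_ne_zero
  have hwab : w = α + β := by rw [hα, hβ]; ring
  have hζab : ζ = β - α := by rw [hα, hβ]; ring
  have hsum : ‖α‖ ^ 2 + ‖β‖ ^ 2 = 1 := by
    have := parallelogram_law_with_norm ℝ w ζ
    rw [hw, hζ] at this
    simp only [hα, hβ, norm_div, Complex.norm_ofNat]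
    linarith
  have hre : (β / α).re = 0 := by
    have h1 : ‖α + β‖ ^ 2 = ‖β - α‖ ^ 2 := by rw [← hwab, ← hζab, hw, hζ]
    rw [Complex.sq_norm, Complex.sq_norm, Complex.normSq_apply, Complex.normSq_apply] at h1
    simp only [Complex.add_re, Complex.add_im, Complex.sub_re, Complex.sub_im] at h1
    rw [Complex.div_re, ← add_div]
    have : β.re * α.re + β.im * α.im = 0 := by linarith
    rw [this, zero_div]
  have hS : 0 < ‖α‖ := norm_pos_iff.2 hα0
  have hS1 : ‖α‖ ≤ 1 := by nlinarith [sq_nonneg ‖β‖]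
  have hC1 : ‖β‖ < 1 := by nlinarith [norm_nonneg β]
  have hsα := sin_ne_zero_of_norm_lt (by linarith) hα0
  have hcβ := cos_ne_zero_of_norm_lt (z := β) (by linarith)
  have hr0 : (r : ℂ) ≠ 0 := by exact_mod_cast hr.ne'
  have hV : w / 2 * ((1 / α - Complex.cos α / Complex.sin α) + Complex.tan β) =
      1 / 2 + β / α / 2 + (r⁻¹ : ℝ) * q := by
    have h1 : -2 * Complex.sin α * Complex.cos β * q =
        r * (w * (Complex.cos α * Complex.cos β - Complex.sin α * Complex.sin β)) := by
      have h2 : (Complex.sin ζ - Complex.sin w) * q = r * (w * Complex.cos w) := by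
        rw [heq]; field_simp; ring
      have h3 : Complex.sin ζ - Complex.sin w = -2 * Complex.sin α * Complex.cos β := by
        rw [hwab, hζab, Complex.sin_add, Complex.sin_sub]; ring
      have h4 : Complex.cos w = Complex.cos α * Complex.cos β - Complex.sin α * Complex.sin β := by
        rw [hwab, Complex.cos_add]
      rw [← h3, h2, h4]
    rw [Complex.tan_eq_sin_div_cos]
    push_cast
    have h5 : w / 2 * (1 / α) = 1 / 2 + β / α / 2 := by
      rw [hwab]; field_simp
    have h6 : w / 2 * (Complex.sin β / Complex.cos β - Complex.cos α / Complex.sin α) =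
        (r : ℂ)⁻¹ * q := by
      field_simp
      linear_combination h1
    linear_combination h5 + h6
  have hE : ‖w / 2 * ((1 / α - Complex.cos α / Complex.sin α) + Complex.tan β)‖ ≤
      (‖β‖ / tanDenom ‖β‖ + ‖α‖ * (1 / 3 + 59 / 400 * ‖α‖ ^ 2)) / 2 := by
    rw [norm_mul, norm_div, hw, Complex.norm_ofNat]
    have h1 := norm_add_le (1 / α - Complex.cos α / Complex.sin α) (Complex.tan β)
    have h2 := norm_tan_le hC1
    have h3 := norm_inv_sub_cot_le hS1 hα0
    linarith
  rw [hV] at hE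
  have hB := tan_cot_bound_lt hS (norm_nonneg β) hsum
  set Z := β / α with hZ
  have hZim : |Z.im| = ‖β‖ / ‖α‖ := by
    rw [← norm_div, ← hZ, ← Complex.abs_im_eq_norm.2 hre]
  set V := 1 / 2 + Z / 2 + (r⁻¹ : ℝ) * q with hVdef
  have hVre : V.re = 1 / 2 + r⁻¹ * q.re := by
    simp [hVdef, hre]
  have hVim : V.im = Z.im / 2 + r⁻¹ * q.im := by
    simp [hVdef]
  have hnorm : V.re + |V.im| / 4 ≤ 2577 / 2500 * ‖V‖ := by
    have h1 : ‖V‖ ^ 2 = V.re ^ 2 + |V.im| ^ 2 := by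
      rw [Complex.sq_norm, Complex.normSq_apply, sq_abs]; ring
    refine le_of_sq_le_sq ?_ (by positivity)
    nlinarith [sq_nonneg (V.re / 4 - |V.im|), sq_nonneg V.re, sq_nonneg |V.im|]
  have hlow : 1 / 2 + ‖β‖ / (8 * ‖α‖) ≤ V.re + |V.im| / 4 := by
    have h1 : |Z.im / 2| ≤ |V.im| + |r⁻¹ * q.im| := by
      rw [show Z.im / 2 = V.im - r⁻¹ * q.im by rw [hVim]; ring]
      exact abs_sub _ _
    have h2 : |r⁻¹ * q.im| ≤ 4 * (r⁻¹ * q.re) := by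
      rw [abs_mul, abs_of_pos (inv_pos.2 hr)]
      have := mul_le_mul_of_nonneg_left hq4 (inv_pos.2 hr).le
      linarith
    have h3 : |Z.im / 2| = 4 * (‖β‖ / (8 * ‖α‖)) := by
      rw [abs_div, hZim, abs_two]; field_simp; ring
    rw [hVre]
    linarith
  linarith

theorem sin_image_ball_mem_nhds {ζ : ℂ} (h : ‖ζ‖ < 1) :
    Complex.sin '' ball 0 1 ∈ nhds (Complex.sin ζ) := by
  have hc := cos_ne_zero_of_norm_lt (z := ζ) (by linarith)
  rw [← (Complex.hasStrictDerivAt_sin ζ).map_nhds_eq hc]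
  exact Filter.image_mem_map (isOpen_ball.mem_nhds (by simpa using h))

/-- The rays arising at boundary points of `sin 𝔻` never meet `sin 𝔻`. -/
theorem sin_ne_add_ray {w v : ℂ} (hw : ‖w‖ = 1) (hv : ‖v‖ < 1)
    {r c : ℝ} (hr : 0 ≤ r) (hc : 0 ≤ c) :
    Complex.sin v ≠ Complex.sin w + r * (w * Complex.cos w / (1 + c + Complex.sin w)) := by
  intro heq
  have hA := abs_im_sin_lt hw
  set d := w * Complex.cos w / (1 + c + Complex.sin w) with hd
  have hd0 : d ≠ 0 := by
    refine div_ne_zero (mul_ne_zero (norm_ne_zero_iff.1 (by simp [hw]))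
      (cos_ne_zero_of_norm_lt (by rw [hw]; norm_num))) ?_
    intro h0
    have h1 := congrArg Complex.re h0
    have := abs_nonneg (Complex.sin w).im
    simp at h1
    linarith
  have hdn : 0 < ‖d‖ := norm_pos_iff.2 hd0
  set K := Complex.sin '' closedBall 0 1 with hK
  have hKc : IsCompact K := (isCompact_closedBall 0 1).image Complex.continuous_sin
  set T := {s : ℝ | 0 ≤ s ∧ Complex.sin w + s * d ∈ K} with hT
  have hTclosed : IsClosed T :=
    isClosed_Ici.inter (hKc.isClosed.preimage (by fun_prop : Continuous fun s : ℝ => Complex.sin w + s * d))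
  obtain ⟨M, hM⟩ := hKc.isBounded.exists_norm_le
  have hTbdd : BddAbove T := by
    refine ⟨(M + ‖Complex.sin w‖) / ‖d‖, fun s hs => ?_⟩
    rw [le_div_iff₀ hdn]
    have h1 := hM _ hs.2
    have h2 : s * ‖d‖ = ‖(Complex.sin w + s * d) - Complex.sin w‖ := by
      rw [add_sub_cancel_left, norm_mul, Complex.norm_real, Real.norm_of_nonneg hs.1]
    rw [h2]
    exact (norm_sub_le _ _).trans (by linarith)
  have hrT : r ∈ T := ⟨hr, heq ▸ ⟨v, by simpa using hv.le, rfl⟩⟩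
  have hmax := hTclosed.csSup_mem ⟨r, hrT⟩ hTbdd
  set s := sSup T
  obtain ⟨hs0, ζ, hζ, hζs⟩ := hmax
  have hζ1 : ‖ζ‖ = 1 := by
    refine le_antisymm (by simpa using hζ) (not_lt.1 fun hlt => ?_)
    have h1 := sin_image_ball_mem_nhds hlt
    rw [hζs] at h1
    have hcont : Continuous fun t : ℝ => Complex.sin w + t * d := by fun_prop
    have h2 := (hcont.tendsto s).eventually h1
    obtain ⟨t, ht1, ht2⟩ := ((h2.filter_mono nhdsWithin_le_nhds).and
      (self_mem_nhdsWithin (s := Ioi s))).exists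
    exact absurd (le_csSup hTbdd ⟨hs0.trans (mem_Ioi.1 ht2).le,
      image_mono ball_subset_closedBall ht1⟩)
      (not_le.2 ht2)
  rcases hs0.eq_or_lt with h0 | h0
  · have hr0 : r = 0 := le_antisymm (h0 ▸ le_csSup hTbdd hrT) hr
    rw [hr0, Complex.ofReal_zero, zero_mul, add_zero] at heq
    have := injOn_sin_ball (by simp; linarith) (by simp [hw]; norm_num) heq
    rw [this, hw] at hv
    exact lt_irrefl _ hv
  · refine sin_ne_add_ray_of_norm_eq hw hζ1 ?_ h0 hc hζs
    rintro rfl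
    rw [left_eq_add] at hζs
    simp [h0.ne', hd0] at hζs

/-- A form of the Jack lemma on boundary points of maximal modulus. -/
theorem exists_nonneg_mul_eq_of_norm_le {ω : ℂ → ℂ} {ω' z₀ : ℂ} (hω : HasDerivAt ω ω' z₀)
    (h1 : ‖ω z₀‖ = 1) (hle : ∀ᶠ z in nhds z₀, ‖z‖ < ‖z₀‖ → ‖ω z‖ ≤ 1) :
    ∃ m : ℝ, 0 ≤ m ∧ z₀ * ω' = m * ω z₀ := by
  rcases eq_or_ne z₀ 0 with hz0 | hz0
  · exact ⟨0, le_rfl, by simp [hz0]⟩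
  set A := (starRingEnd ℂ) (ω z₀) * (z₀ * ω') with hA
  have hww : (starRingEnd ℂ) (ω z₀) * ω z₀ = 1 := by
    rw [Complex.conj_mul', h1]; simp
  have hdir : ∀ η : ℂ, η.re < 0 → (A * η).re ≤ 0 := by
    intro η hη
    have hl : HasDerivAt (fun ε : ℂ => z₀ * (1 + ε * η)) (z₀ * η) ((0 : ℝ) : ℂ) := by
      simpa using (((hasDerivAt_id ((0 : ℝ) : ℂ)).mul_const η).const_add 1).const_mul z₀
    have h2 : HasDerivAt (fun ε : ℂ => (starRingEnd ℂ) (ω z₀) * ω (z₀ * (1 + ε * η)))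
        ((starRingEnd ℂ) (ω z₀) * (ω' * (z₀ * η))) ((0 : ℝ) : ℂ) :=
      (HasDerivAt.comp ((0 : ℝ) : ℂ) (by simpa using hω) hl).const_mul _
    have h3 := h2.real_of_complex
    have h4 := h3.tendsto_slope_zero_right
    have e : ((starRingEnd ℂ) (ω z₀) * (ω' * (z₀ * η))).re = (A * η).re := by
      rw [hA]; congr 1; ring
    rw [e] at h4
    refine le_of_tendsto h4 ?_
    have hlt : Filter.Tendsto (fun ε : ℝ => z₀ * (1 +
      (ε : ℂ) * η)) (nhdsWithin 0 (Ioi 0)) (nhds z₀) := by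
      have hc : Continuous fun ε : ℝ => z₀ * (1 + (ε : ℂ) * η) := by fun_prop
      have := hc.tendsto 0
      simp only [Complex.ofReal_zero, zero_mul, add_zero, mul_one] at this
      exact this.mono_left nhdsWithin_le_nhds
    have hsmall : ∀ᶠ ε : ℝ in nhdsWithin 0 (Ioi 0), 2 * η.re + ε * Complex.normSq η < 0 := by
      have hc : Continuous fun ε : ℝ => 2 * η.re + ε * Complex.normSq η := by fun_prop
      exact (hc.tendsto 0).mono_left nhdsWithin_le_nhds |>.eventually_lt_const (by simp; linarith)
    filter_upwards [hlt.eventually hle, hsmall, self_mem_nhdsWithin] with ε hε hs hpos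
    have hpos' : 0 < ε := hpos
    have hnorm : ‖z₀ * (1 + (ε : ℂ) * η)‖ < ‖z₀‖ := by
      rw [norm_mul]
      refine mul_lt_of_lt_one_right (norm_pos_iff.2 hz0) ?_
      have h5 : ‖1 + (ε : ℂ) * η‖ ^ 2 = 1 + ε * (2 * η.re + ε * Complex.normSq η) := by
        rw [Complex.sq_norm, Complex.normSq_apply, Complex.normSq_apply]
        simp; ring
      have h6 := mul_neg_of_pos_of_neg hpos' hs
      nlinarith [norm_nonneg (1 + (ε : ℂ) * η)]
    have h7 : ((starRingEnd ℂ) (ω z₀) * ω (z₀ * (1 + (ε : ℂ) * η))).re ≤ 1 := by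
      refine (Complex.re_le_norm _).trans ?_
      rw [norm_mul, Complex.norm_conj, h1, one_mul]
      exact hε hnorm
    simp only [zero_add, smul_eq_mul, Complex.ofReal_zero, zero_mul, add_zero, mul_one, hww,
      Complex.one_re]
    exact mul_nonpos_of_nonneg_of_nonpos (inv_nonneg.2 hpos'.le) (by linarith)
  have hk : ∀ k : ℝ, -A.re - k * A.im ≤ 0 := by
    intro k
    have := hdir ⟨-1, k⟩ (by norm_num)
    rw [Complex.mul_re] at this
    simp only at this
    linarith
  have him : A.im = 0 := by
    by_contra h0
    have := hk (-(A.re + 1) / A.im)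
    rw [div_mul_cancel₀ _ h0] at this
    linarith
  refine ⟨A.re, by have := hk 0; linarith, ?_⟩
  have hAr : (A.re : ℂ) = A := by
    apply Complex.ext <;> simp [him]
  rw [hAr, hA]
  linear_combination (-(z₀ * ω')) * hww

theorem exists_nonneg_mul_deriv_eq_of_mem_sin_image {u : ℂ → ℂ} {u' z₀ w : ℂ}
    (hu : HasDerivAt u u' z₀) (hw : ‖w‖ = 1) (huw : u z₀ = Complex.sin w)
    (hmem : ∀ z, ‖z‖ < ‖z₀‖ → u z ∈ Complex.sin '' ball 0 1) :
    ∃ m : ℝ, 0 ≤ m ∧ z₀ * u' = m * (w * Complex.cos w) := by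
  have hc := cos_ne_zero_of_norm_lt (z := w) (by rw [hw]; norm_num)
  have hs := Complex.hasStrictDerivAt_sin w
  set L := hs.localInverse Complex.sin (Complex.cos w) w hc with hL
  have hLw : L (Complex.sin w) = w := HasStrictFDerivAt.localInverse_apply_image _
  have hLd : HasDerivAt L (Complex.cos w)⁻¹ (u z₀) := by
    rw [huw]; exact (hs.to_localInverse hc).hasDerivAt
  have hright : ∀ᶠ y in nhds (Complex.sin w), Complex.sin (L y) = y :=
    HasStrictFDerivAt.eventually_right_inverse _
  have hLuz : L (u z₀) = w := by rw [huw, hLw]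
  have hω := hLd.comp z₀ hu
  have hlt : ∀ᶠ z in nhds z₀, ‖L (u z)‖ < 3 / 2 := by
    have := hω.continuousAt.norm
    refine this.eventually_lt_const ?_
    simp only [Function.comp, hLuz, hw]
    norm_num
  have hri : ∀ᶠ z in nhds z₀, Complex.sin (L (u z)) = u z := by
    have := hu.continuousAt
    rw [← huw] at hright
    exact this.eventually hright
  obtain ⟨m, hm, h⟩ := exists_nonneg_mul_eq_of_norm_le hω
    (by simp only [Function.comp, hLuz, hw]) (by
      filter_upwards [hlt, hri] with z h1 h2 hz
      obtain ⟨v, hv, hvu⟩ := hmem z hz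
      rw [mem_ball_zero_iff] at hv
      have : v = L (u z) :=
        injOn_sin_ball (by simp; linarith) (by simpa using h1) (hvu.trans h2.symm)
      simp only [Function.comp, ← this]
      exact hv.le)
  refine ⟨m, hm, ?_⟩
  simp only [Function.comp, hLuz] at h
  field_simp at h
  rw [h]; ring

/-- The Briot–Bouquet type subordination behind the Bernardi transform: the logarithmic derivative
of `G` stays in `sin 𝔻` as soon as that of `g` does. -/
theorem mem_sin_image_of_briotBouquet {c : ℝ} (hc : 0 ≤ c) {g G G' : ℂ → ℂ}
    (hg : DifferentiableOn ℂ g (ball 0 1)) (hg0 : ∀ z ∈ ball (0 : ℂ) 1, g z ≠ 0)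
    (hG : ContinuousOn G (ball 0 1)) (hG0 : G 0 = g 0)
    (hGd : ∀ z ∈ ball (0 : ℂ) 1, z ≠ 0 → HasDerivAt G (G' z) z)
    (hode : ∀ z ∈ ball (0 : ℂ) 1, z ≠ 0 → z * G' z = (1 + c) * (g z - G z))
    (hsub : ∀ z ∈ ball (0 : ℂ) 1, z ≠ 0 → z * deriv g z / g z ∈ Complex.sin '' ball 0 1) :
    ∀ z ∈ ball (0 : ℂ) 1, G z ≠ 0 ∧ (1 + c) * (g z / G z - 1) ∈ Complex.sin '' ball 0 1 := by
  have hc1 : (1 + c : ℂ) ≠ 0 := by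
    intro h; have := congrArg Complex.re h; simp at this; linarith
  set u : ℂ → ℂ := fun z => (1 + c) * (g z / G z - 1) with hu
  have hgc : ∀ z ∈ ball (0 : ℂ) 1, ContinuousAt g z := fun z hz =>
    hg.continuousOn.continuousAt (isOpen_ball.mem_nhds hz)
  have hGc : ∀ z ∈ ball (0 : ℂ) 1, ContinuousAt G z := fun z hz =>
    hG.continuousAt (isOpen_ball.mem_nhds hz)
  have huc : ∀ z ∈ ball (0 : ℂ) 1, G z ≠ 0 → ContinuousAt u z := fun z hz h0 =>
    (((hgc z hz).div (hGc z hz) h0).sub continuousAt_const).const_mul _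
  set U : Set ℂ := {z | z ∈ ball (0 : ℂ) 1 ∧ G z ≠ 0 ∧ u z ∈ Complex.sin '' ball 0 1} with hU
  have hUo : IsOpen U := by
    rw [isOpen_iff_mem_nhds]
    rintro z ⟨hz, h0, v, hv, hvu⟩
    have h1 := sin_image_ball_mem_nhds (mem_ball_zero_iff.1 hv)
    rw [hvu] at h1
    filter_upwards [isOpen_ball.mem_nhds hz, (hGc z hz).eventually_ne h0, huc z hz h0 h1]
      with y a b d using ⟨a, b, d⟩
  have h0b : (0 : ℂ) ∈ ball (0 : ℂ) 1 := mem_ball_self one_pos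
  have h0U : (0 : ℂ) ∈ U := by
    refine ⟨h0b, hG0 ▸ hg0 0 h0b, 0, h0b, ?_⟩
    simp [hu, hG0, div_self (hg0 0 h0b)]
  suffices h : ∀ z ∈ ball (0 : ℂ) 1, z ∈ U from fun z hz => (h z hz).2
  by_contra! hbad
  obtain ⟨z₁, hz₁, hz₁U⟩ := hbad
  obtain ⟨z₀, ⟨hz₀, hz₀U⟩, hmin⟩ := ((isCompact_closedBall (0 : ℂ) ‖z₁‖).diff hUo).exists_isMinOn
    ⟨z₁, by simp, hz₁U⟩ continuous_norm.continuousOn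
  rw [mem_ball_zero_iff] at hz₁
  rw [mem_closedBall_zero_iff] at hz₀
  have hz₀b : z₀ ∈ ball (0 : ℂ) 1 := mem_ball_zero_iff.2 (hz₀.trans_lt hz₁)
  have hlt : ∀ z, ‖z‖ < ‖z₀‖ → z ∈ U := by
    intro z hz
    by_contra hzU
    exact absurd (hmin ⟨mem_closedBall_zero_iff.2 (hz.le.trans hz₀), hzU⟩) (not_le.2 hz)
  have hz₀0 : z₀ ≠ 0 := fun h => hz₀U (h ▸ h0U)
  have hz₀n : ‖z₀‖ ≠ 0 := norm_ne_zero_iff.2 hz₀0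
  have : (nhdsWithin z₀ (ball (0 : ℂ) ‖z₀‖)).NeBot := by
    rw [← mem_closure_iff_nhdsWithin_neBot, closure_ball _ hz₀n]; simp
  have hin : ∀ᶠ z in nhdsWithin z₀ (ball (0 : ℂ) ‖z₀‖), z ∈ U := by
    filter_upwards [self_mem_nhdsWithin] with z hz using hlt z (mem_ball_zero_iff.1 hz)
  have hGz₀ : G z₀ ≠ 0 := by
    have hle : ‖(1 + c) * g z₀‖ ≤ (3 + c) * ‖G z₀‖ := by
      have hl : Filter.Tendsto (fun z => ‖(1 + c) * g z‖) (nhdsWithin z₀ (ball (0 : ℂ) ‖z₀‖))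
          (nhds ‖(1 + c) * g z₀‖) :=
        ((hgc z₀ hz₀b).const_mul _).norm.tendsto.mono_left nhdsWithin_le_nhds
      have hr : Filter.Tendsto (fun z => (3 + c) * ‖G z‖) (nhdsWithin z₀ (ball (0 : ℂ) ‖z₀‖))
          (nhds ((3 + c) * ‖G z₀‖)) :=
        ((hGc z₀ hz₀b).norm.const_mul _).tendsto.mono_left nhdsWithin_le_nhds
      refine le_of_tendsto_of_tendsto hl hr ?_
      filter_upwards [hin] with z ⟨_, hz0, v, hv, hvu⟩
      have e : (1 + c) * g z = (u z + (1 + c)) * G z := by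
        simp only [hu]; field_simp; ring
      rw [mem_ball_zero_iff] at hv
      have hsin : ‖Complex.sin v‖ ≤ 2 := by
        have h1 := Complex.sin_bound hv.le
        have h2 := norm_le_norm_add_norm_sub' (Complex.sin v) (v - v ^ 3 / 6)
        have h3 := norm_sub_le v (v ^ 3 / 6)
        simp only [norm_div, norm_pow, Complex.norm_ofNat] at h3
        have := pow_le_one₀ (norm_nonneg v) hv.le (n := 3)
        have := pow_le_one₀ (norm_nonneg v) hv.le (n := 5)
        linarith
      rw [e, norm_mul, ← hvu]
      gcongr
      refine (norm_add_le _ _).trans ?_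
      have : ‖(1 + c : ℂ)‖ = 1 + c := by
        rw [show (1 + c : ℂ) = ((1 + c : ℝ) : ℂ) by push_cast; rfl, Complex.norm_real,
          Real.norm_of_nonneg (by linarith)]
      linarith
    intro h0
    rw [h0, norm_zero, mul_zero] at hle
    exact mul_ne_zero hc1 (hg0 z₀ hz₀b) (norm_le_zero_iff.1 hle)
  have hcl : u z₀ ∈ Complex.sin '' closedBall 0 1 :=
    ((isCompact_closedBall 0 1).image Complex.continuous_sin).isClosed.mem_of_tendsto
      ((huc z₀ hz₀b hGz₀).tendsto.mono_left nhdsWithin_le_nhds)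
      (hin.mono fun z hz => image_mono ball_subset_closedBall hz.2.2)
  obtain ⟨w, hw, hwu⟩ := hcl
  rw [mem_closedBall_zero_iff] at hw
  have hw1 : ‖w‖ = 1 := le_antisymm hw (not_lt.1 fun h =>
    hz₀U ⟨hz₀b, hGz₀, w, mem_ball_zero_iff.2 h, hwu⟩)
  have hgd := (hg.differentiableAt (isOpen_ball.mem_nhds hz₀b)).hasDerivAt
  have hud : HasDerivAt u ((1 + c) * ((deriv g z₀ * G z₀ - g z₀ * G' z₀) / G z₀ ^ 2)) z₀ :=
    ((hgd.div (hGd z₀ hz₀b hz₀0) hGz₀).sub_const 1).const_mul _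
  obtain ⟨m, hm, hmu⟩ := exists_nonneg_mul_deriv_eq_of_mem_sin_image hud hw1 hwu.symm
    fun z hz => (hlt z hz).2.2
  obtain ⟨v, hv, hvg⟩ := hsub z₀ hz₀b hz₀0
  refine sin_ne_add_ray hw1 (mem_ball_zero_iff.1 hv) hm hc ?_
  have hgz := hg0 z₀ hz₀b
  have e1 : (1 + c + Complex.sin w : ℂ) = (1 + c) * g z₀ / G z₀ := by
    rw [hwu]; simp only [hu]; ring
  have ho := hode z₀ hz₀b hz₀0
  rw [hvg, e1, ← mul_div_assoc, ← hmu, hwu]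
  simp only [hu]
  field_simp
  linear_combination (g z₀) * ho

theorem continuousAt_update_div_pow {g H : ℂ → ℂ} {c : ℕ} (hg : ContinuousAt g 0)
    (hH0 : H 0 = 0) (hH : ∀ z ∈ ball (0 : ℂ) 1, HasDerivAt H (g z * z ^ c) z) :
    ContinuousAt (Function.update (fun z => (1 + c) * H z / z ^ (c + 1)) 0 (g 0)) 0 := by
  have hc : (1 + c : ℂ) ≠ 0 := by rw [add_comm]; exact Nat.cast_add_one_ne_zero c
  rw [continuousAt_update_same, Metric.tendsto_nhdsWithin_nhds]
  intro ε hε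
  have hε' : 0 < ε / (2 * (1 + c)) := by positivity
  obtain ⟨δ, hδ, hgδ⟩ := Metric.continuousAt_iff.1 hg _ hε'
  refine ⟨min δ 1, by positivity, fun {z} hz hzδ => ?_⟩
  have hz0 : z ≠ 0 := hz
  rw [dist_zero_right, lt_min_iff] at hzδ
  set K : ℂ → ℂ := fun y => H y - g 0 * y ^ (c + 1) / (1 + c) with hK
  have hKd : ∀ y ∈ closedBall (0 : ℂ) ‖z‖,
      HasDerivWithinAt K ((g y - g 0) * y ^ c) (closedBall 0 ‖z‖) y := by
    intro y hy
    rw [mem_closedBall_zero_iff] at hy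
    have h1 := ((hasDerivAt_pow (c + 1) y).const_mul (g 0)).div_const (1 + c : ℂ)
    have h2 := (hH y (mem_ball_zero_iff.2 (hy.trans_lt hzδ.2))).sub h1
    refine (h2.congr_deriv ?_).hasDerivWithinAt
    push_cast
    rw [add_comm (c : ℂ) 1]
    field_simp
  have hbound : ∀ y ∈ closedBall (0 : ℂ) ‖z‖,
      ‖(g y - g 0) * y ^ c‖ ≤ ε / (2 * (1 + c)) * ‖z‖ ^ c := by
    intro y hy
    rw [mem_closedBall_zero_iff] at hy
    have h1 : dist (g y) (g 0) < ε / (2 * (1 + c)) :=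
      hgδ (by rw [dist_zero_right]; exact hy.trans_lt hzδ.1)
    rw [dist_eq_norm] at h1
    rw [norm_mul, norm_pow]
    gcongr
  have hmv := (convex_closedBall (0 : ℂ) ‖z‖).norm_image_sub_le_of_norm_hasDerivWithin_le
    hKd hbound (mem_closedBall_self (norm_nonneg z)) (y := z) (by simp)
  have hK0 : K 0 = 0 := by simp [hK, hH0]
  rw [hK0, sub_zero, sub_zero] at hmv
  have hzn : 0 < ‖z‖ := norm_pos_iff.2 hz0
  have hcn : ‖(1 + c : ℂ)‖ = 1 + c := by
    rw [show (1 + c : ℂ) = ((1 + c : ℝ) : ℂ) by push_cast; rfl, Complex.norm_real,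
      Real.norm_of_nonneg (by positivity)]
  have e : (1 + c) * H z / z ^ (c + 1) - g 0 = (1 + c) * K z / z ^ (c + 1) := by
    simp only [hK]; field_simp
  rw [dist_eq_norm, e, norm_div, norm_mul, norm_pow, hcn, div_lt_iff₀ (by positivity)]
  calc (1 + c) * ‖K z‖ ≤ (1 + c) * (ε / (2 * (1 + c)) * ‖z‖ ^ c * ‖z‖) := by gcongr
    _ = ε / 2 * ‖z‖ ^ (c + 1) := by field_simp; ring
    _ < ε * ‖z‖ ^ (c + 1) := by gcongr; linarith

theorem segIntegral_eq_of_hasDerivAt {h H : ℂ → ℂ} (hh : ContinuousOn h (ball 0 1))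
    (hH0 : H 0 = 0) (hH : ∀ z ∈ ball (0 : ℂ) 1, HasDerivAt H (h z) z) {z : ℂ}
    (hz : z ∈ ball (0 : ℂ) 1) : segIntegral h z = H z := by
  have hmem : ∀ t ∈ Icc (0 : ℝ) 1, 0 + t • z ∈ ball (0 : ℂ) 1 := by
    intro t ht
    rw [mem_ball_zero_iff] at hz ⊢
    rw [zero_add, norm_smul, Real.norm_of_nonneg ht.1]
    exact (mul_le_of_le_one_left (norm_nonneg z) ht.2).trans_lt hz
  have := intervalIntegral.integral_unitInterval_deriv_eq_sub (𝕜 := ℂ) (f := H) (f' := h)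
    (z₀ := 0) (z₁ := z) (hh.comp (by fun_prop) hmem) fun t ht => hH _ (hmem t ht)
  simpa [segIntegral, hH0] using this

/-- For `Ψ(z) = 1 + sin z` and `c = 0, 1, 2, ⋯`, the Bernardi transform
preserves the class `S*_s = {f : z f'/f ≺ 1 + sin z}`. -/
theorem bernardi_preserves_sine_class (c : ℕ)
    (f : ℂ → ℂ) (hf : AnalyticOnNhd ℂ f (ball 0 1)) (hf0 : f 0 = 0) (hf1 : deriv f 0 = 1)
    (hsub : ∀ z ∈ ball (0 : ℂ) 1, z ≠ 0 →
      f z ≠ 0 ∧ z * deriv f z / f z ∈ (fun w : ℂ => 1 + Complex.sin w) '' ball 0 1) :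
    ∀ z ∈ ball (0 : ℂ) 1, z ≠ 0 →
      bernardi c f z ≠ 0 ∧ z * deriv (bernardi c f) z / bernardi c f z ∈
        (fun w : ℂ => 1 + Complex.sin w) '' ball 0 1 := by
  have hc : (1 + c : ℂ) ≠ 0 := by rw [add_comm]; exact Nat.cast_add_one_ne_zero c
  have h0b : (0 : ℂ) ∈ ball (0 : ℂ) 1 := mem_ball_self one_pos
  set g : ℂ → ℂ := dslope f 0 with hgdef
  have hgne : ∀ z, z ≠ 0 → g z = f z / z := fun z hz => by
    rw [hgdef, dslope_of_ne _ hz, slope_def_field, hf0, sub_zero, sub_zero]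
  have hg00 : g 0 = 1 := by rw [hgdef, dslope_same, hf1]
  have hg : DifferentiableOn ℂ g (ball 0 1) :=
    (differentiableOn_dslope (isOpen_ball.mem_nhds h0b)).2 hf.differentiableOn
  have hg0 : ∀ z ∈ ball (0 : ℂ) 1, g z ≠ 0 := by
    intro z hz
    rcases eq_or_ne z 0 with rfl | h
    · rw [hg00]; exact one_ne_zero
    · rw [hgne z h]; exact div_ne_zero (hsub z hz h).1 h
  have hgsub : ∀ z ∈ ball (0 : ℂ) 1, z ≠ 0 → z * deriv g z / g z ∈ Complex.sin '' ball 0 1 := by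
    intro z hz h
    obtain ⟨hfz, v, hv, hvf⟩ := hsub z hz h
    refine ⟨v, hv, ?_⟩
    have hd : deriv g z = (deriv f z * z - f z * 1) / z ^ 2 := by
      have h1 := (hf z hz).differentiableAt.hasDerivAt.div (hasDerivAt_id z) h
      refine (h1.congr_of_eventuallyEq ?_).deriv
      filter_upwards [isOpen_ne.mem_nhds h] with y hy using hgne y hy
    have hvf' : 1 + Complex.sin v = z * deriv f z / f z := hvf
    rw [hd, hgne z h, ← add_right_inj 1, hvf']
    field_simp
    ring
  have hint : bernardiIntegrand c f = fun ζ => g ζ * ζ ^ c := by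
    funext ζ
    unfold bernardiIntegrand
    split_ifs with h
    · rw [h, hg00, hf1]
    · rw [hgne ζ h]
  have hhd : DifferentiableOn ℂ (fun ζ => g ζ * ζ ^ c) (ball 0 1) := hg.mul (by fun_prop)
  obtain ⟨H, hH0, hH⟩ := hhd.isExactOn_ball.with_val_at 0 0
  set G : ℂ → ℂ := Function.update (fun z => (1 + c) * H z / z ^ (c + 1)) 0 (g 0) with hGdef
  have hGne : ∀ z, z ≠ 0 → G z = (1 + c) * H z / z ^ (c + 1) := fun z hz => by
    rw [hGdef, Function.update_of_ne hz]
  set G' : ℂ → ℂ := fun z => (1 + c) * (g z - G z) / z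
  have hGd : ∀ z ∈ ball (0 : ℂ) 1, z ≠ 0 → HasDerivAt G (G' z) z := by
    intro z hz h
    have h1 := ((hH z hz).const_mul (1 + c : ℂ)).div (hasDerivAt_pow (c + 1) z) (pow_ne_zero _ h)
    refine (h1.congr_of_eventuallyEq ?_).congr_deriv ?_
    · filter_upwards [isOpen_ne.mem_nhds h] with y hy using hGne y hy
    · simp only [G', hGne z h]
      push_cast
      field_simp
      ring
  have hG : ContinuousOn G (ball 0 1) := by
    intro z hz
    rcases eq_or_ne z 0 with rfl | h
    · exact (continuousAt_update_div_pow
        (hg.continuousOn.continuousAt (isOpen_ball.mem_nhds hz)) hH0 hH).continuousWithinAt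
    · exact (hGd z hz h).continuousAt.continuousWithinAt
  have key := mem_sin_image_of_briotBouquet (c := c) (Nat.cast_nonneg c) hg hg0 hG
    (Function.update_self ..) hGd (fun z _ h => by simp only [G']; push_cast; field_simp) hgsub
  have hB : ∀ z ∈ ball (0 : ℂ) 1, z ≠ 0 → bernardi c f z = z * G z := by
    intro z hz h
    rw [bernardi, if_neg h, hint, segIntegral_eq_of_hasDerivAt hhd.continuousOn hH0 hH hz,
      hGne z h]
    field_simp
    ring
  intro z hz h
  obtain ⟨hGz, v, hv, hvG⟩ := key z hz
  have hBd : deriv (bernardi c f) z = 1 * G z + z * G' z := by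
    refine (((hasDerivAt_id z).mul (hGd z hz h)).congr_of_eventuallyEq ?_).deriv
    filter_upwards [isOpen_ne.mem_nhds h, isOpen_ball.mem_nhds hz] with y hy hyb using hB y hyb hy
  refine ⟨by rw [hB z hz h]; exact mul_ne_zero h hGz, v, hv, ?_⟩
  rw [hBd, hB z hz h]
  simp only [hvG, G']
  push_cast
  field_simp
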